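/- Let T be a strictly singular, injective bounded linear operator on an infinite dimensional Banach space X, let k be a positive integer and η > 0. Then for every infinite dimensional closed subspace Y of X there exists an infinite dimensional closed subspace Z of Y such that for all z ∈ Z and all i = 1, ..., k one has ‖T^i z‖ ≤ η ‖T^{i-1} z‖ (where T^0 denotes the identity operator on X). -/

import Mathlib

/-- A bounded linear operator `T` on a normed space `X` is strictly singular if for every
infinite dimensional closed subspace `Y` of `X`, the restriction of `T` to `Y` is not
bounded below. -/
def StrictlySingular {X : Type*} [NormedAddCommGroup X] [NormedSpace ℝ X]
    (T : X →L[ℝ] X) : Prop :=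
  ∀ Y : Submodule ℝ X, IsClosed (Y : Set X) → ¬ FiniteDimensional ℝ Y →
    ¬ ∃ c : ℝ, 0 < c ∧ ∀ y ∈ Y, c * ‖y‖ ≤ ‖T y‖


theorem aux_small {X : Type*} [NormedAddCommGroup X] [NormedSpace ℝ X]
    (T : X →L[ℝ] X) (hT : StrictlySingular T) (V : Submodule ℝ X)
    (hV : ¬ FiniteDimensional ℝ V) (δ : ℝ) (hδ : 0 < δ) :
    ∃ v ∈ V, ‖v‖ = 1 ∧ ‖T v‖ ≤ δ := by
  by_contra hcon
  push Not at hcon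
  have hb : ∀ v ∈ V, δ * ‖v‖ ≤ ‖T v‖ := by
    intro v hv
    by_cases h0 : v = 0
    · simp [h0]
    have hn : 0 < ‖v‖ := norm_pos_iff.mpr h0
    have h := hcon (‖v‖⁻¹ • v) (V.smul_mem _ hv) (by
      rw [norm_smul, norm_inv, norm_norm, inv_mul_cancel₀ hn.ne'])
    rw [map_smul, norm_smul, norm_inv, norm_norm, inv_mul_eq_div, lt_div_iff₀ hn] at h
    exact h.le
  refine hT V.topologicalClosure V.isClosed_topologicalClosure ?_ ⟨δ, hδ, ?_⟩
  · intro hfin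
    exact hV (Submodule.finiteDimensional_of_le V.le_topologicalClosure)
  · intro y hy
    have hcl : IsClosed {y : X | δ * ‖y‖ ≤ ‖T y‖} :=
      isClosed_le (by fun_prop) (by fun_prop)
    exact closure_minimal (s := (V : Set X)) hb hcl hy

theorem aux_ker {X : Type*} [NormedAddCommGroup X] [NormedSpace ℝ X]
    (V : Submodule ℝ X) (hV : ¬ FiniteDimensional ℝ V) (f : X →ₗ[ℝ] ℝ) :
    ¬ FiniteDimensional ℝ (V ⊓ LinearMap.ker f : Submodule ℝ X) := by
  intro h
  apply hV
  have h1 : (V ⊓ LinearMap.ker f).FG := Module.Finite.iff_fg.mp h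
  have h2 : (V.map f).FG := IsNoetherian.noetherian _
  exact Module.Finite.iff_fg.mpr (Submodule.fg_of_fg_map_of_fg_inf_ker f h2 h1)

theorem aux_fin {X ι : Type*} [NormedAddCommGroup X] [NormedSpace ℝ X]
    (V : Submodule ℝ X) (hV : ¬ FiniteDimensional ℝ V) (g : ι → X →L[ℝ] ℝ) (s : Finset ι) :
    ∃ W : Submodule ℝ X, W ≤ V ∧ ¬ FiniteDimensional ℝ W ∧ ∀ i ∈ s, ∀ w ∈ W, g i w = 0 := by
  classical
  induction s using Finset.induction_on with
  | empty => exact ⟨V, le_rfl, hV, by simp⟩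
  | insert a s ha ih =>
    obtain ⟨W, hWV, hW, hs⟩ := ih
    refine ⟨W ⊓ LinearMap.ker (g a).toLinearMap, inf_le_left.trans hWV, aux_ker W hW _, ?_⟩
    intro i hi w hw
    rcases Finset.mem_insert.mp hi with rfl | hi
    · exact hw.2
    · exact hs i hi w hw.1

theorem aux_delta {ι : Type*} (d : ι → ℝ) (s : Finset ι) (hs : ∀ i ∈ s, 0 < d i) :
    ∃ δ : ℝ, 0 < δ ∧ δ ≤ 1 / 2 ∧ ∀ i ∈ s, δ ≤ d i / 4 := by
  classical
  induction s using Finset.induction_on with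
  | empty => exact ⟨1 / 2, by norm_num, le_rfl, by simp⟩
  | insert a s ha ih =>
    obtain ⟨δ, h0, h1, h2⟩ := ih (fun i hi => hs i (Finset.mem_insert_of_mem hi))
    have hda := hs a (Finset.mem_insert_self _ _)
    refine ⟨min δ (d a / 4), lt_min h0 (by positivity), (min_le_left _ _).trans h1, ?_⟩
    intro i hi
    rcases Finset.mem_insert.mp hi with rfl | hi
    · exact min_le_right _ _
    · exact (min_le_left _ _).trans (h2 i hi)

theorem aux_coef {X : Type*} [NormedAddCommGroup X] [NormedSpace ℝ X]
    (x : ℕ → X) (f : ℕ → X →L[ℝ] ℝ) (hx : ∀ n, ‖x n‖ = 1) (hf : ∀ n, ‖f n‖ ≤ 1)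
    (hd : ∀ n, f n (x n) = 1) (ho : ∀ m n, m < n → f m (x n) = 0) (c : ℕ →₀ ℝ) (n : ℕ) :
    |c n| ≤ 2 ^ n * ‖Finsupp.linearCombination ℝ x c‖ := by
  induction n using Nat.strong_induction_on with
  | _ n ih =>
    set z := Finsupp.linearCombination ℝ x c with hz
    have hle : ∀ y, |f n y| ≤ ‖y‖ := fun y => by
      have := (f n).le_of_opNorm_le (hf n) y
      simpa using this
    have h1 : f n z = ∑ i ∈ Finset.range (n + 1), c i * f n (x i) := by
      rw [hz, Finsupp.linearCombination_apply, Finsupp.sum, map_sum]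
      simp only [map_smul, smul_eq_mul]
      have e1 : ∑ i ∈ c.support, c i * f n (x i)
          = ∑ i ∈ c.support ∪ Finset.range (n + 1), c i * f n (x i) := by
        apply Finset.sum_subset Finset.subset_union_left
        intro i _ hi
        rw [Finsupp.notMem_support_iff.mp hi, zero_mul]
      rw [e1]
      symm
      apply Finset.sum_subset Finset.subset_union_right
      intro i _ hi
      rw [ho n i (by simpa using hi), mul_zero]
    rw [Finset.sum_range_succ, hd, mul_one] at h1
    have h2 : |∑ i ∈ Finset.range n, c i * f n (x i)| ≤ ∑ i ∈ Finset.range n, 2 ^ i * ‖z‖ := by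
      refine (Finset.abs_sum_le_sum_abs _ _).trans (Finset.sum_le_sum ?_)
      intro i hi
      rw [abs_mul]
      have a1 := ih i (Finset.mem_range.mp hi)
      have a2 : |f n (x i)| ≤ 1 := (hle _).trans (hx i).le
      calc |c i| * |f n (x i)| ≤ |c i| * 1 := by gcongr
        _ ≤ _ := by simpa using a1
    have h3 : ∑ i ∈ Finset.range n, (2:ℝ) ^ i * ‖z‖ = (2 ^ n - 1) * ‖z‖ := by
      rw [← Finset.sum_mul, geom_sum_eq (by norm_num)]
      norm_num
    rw [h3] at h2
    have h4 := hle z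
    rw [abs_le] at *
    constructor <;> nlinarith

theorem aux_core {X : Type*} [NormedAddCommGroup X] [NormedSpace ℝ X]
    (T : X →L[ℝ] X) (hT : StrictlySingular T) (V : Submodule ℝ X)
    (hV : ¬ FiniteDimensional ℝ V) (η : ℝ) (hη : 0 < η) :
    ∃ W : Submodule ℝ X, W ≤ V ∧ ¬ FiniteDimensional ℝ W ∧ ∀ w ∈ W, ‖T w‖ ≤ η * ‖w‖ := by
  have hg : ∀ y : X, ∃ g : X →L[ℝ] ℝ, ‖g‖ ≤ 1 ∧ g y = ‖y‖ := fun y => by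
    obtain ⟨g, h1, h2⟩ := exists_dual_vector'' ℝ y
    exact ⟨g, h1, by simpa using h2⟩
  choose g hg1 hg2 using hg
  obtain ⟨u, hu, hr⟩ := exists_seq_of_forall_finset_exists
    (fun p : X × ℝ => p.1 ∈ V ∧ ‖p.1‖ = 1 ∧ 0 < p.2 ∧ p.2 ≤ 1 / 2 ∧ ‖T p.1‖ ≤ η * p.2)
    (fun p q => g p.1 q.1 = 0 ∧ q.2 ≤ p.2 / 4) (by
      intro s hs
      obtain ⟨δ, h0, h1, h2⟩ := aux_delta (fun p : X × ℝ => p.2) s (fun i hi => (hs i hi).2.2.1)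
      obtain ⟨W, hWV, hW, hker⟩ := aux_fin V hV (fun p : X × ℝ => g p.1) s
      obtain ⟨v, hv, hv1, hv2⟩ := aux_small T hT W hW (η * δ) (by positivity)
      exact ⟨(v, δ), ⟨hWV hv, hv1, h0, h1, hv2⟩, fun p hp => ⟨hker p hp v hv, h2 p hp⟩⟩)
  have hcoef := aux_coef (fun n => (u n).1) (fun n => g (u n).1) (fun n => (hu n).2.1)
    (fun n => hg1 _) (fun n => by rw [hg2, (hu n).2.1]) (fun m n h => (hr m n h).1)
  have hδ : ∀ n, (u n).2 ≤ (1 / 4) ^ n / 2 := by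
    intro n
    induction n with
    | zero => simpa using (hu 0).2.2.2.1
    | succ n ih =>
      have := (hr n (n + 1) (Nat.lt_succ_self n)).2
      rw [pow_succ]
      linarith
  refine ⟨Submodule.span ℝ (Set.range fun n => (u n).1), ?_, ?_, ?_⟩
  · rw [Submodule.span_le]
    rintro _ ⟨n, rfl⟩
    exact (hu n).1
  · intro hfin
    have hli : LinearIndependent ℝ (fun n => (u n).1) := by
      rw [linearIndependent_iff]
      intro c hc
      ext n
      have := hcoef c n
      rw [hc, norm_zero, mul_zero] at this
      simpa using this
    have hli2 := linearIndependent_span hli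
    have := hli2.finite
    exact not_finite ℕ
  · intro w hw
    obtain ⟨c, rfl⟩ := (Finsupp.mem_span_range_iff_exists_finsupp).mp hw
    rw [← Finsupp.linearCombination_apply]
    have hco := hcoef c
    set z := Finsupp.linearCombination ℝ (fun n => (u n).1) c with hz
    have e : T z = ∑ i ∈ c.support, c i • T (u i).1 := by
      rw [hz, Finsupp.linearCombination_apply, Finsupp.sum, map_sum]
      simp only [map_smul]
    rw [e]
    have hsum : ∑ i ∈ c.support, ((1:ℝ) / 2) ^ i ≤ 2 := by
      exact (summable_geometric_two.sum_le_tsum _ (fun i _ => by positivity)).trans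
        tsum_geometric_two.le
    calc ‖∑ i ∈ c.support, c i • T (u i).1‖
        ≤ ∑ i ∈ c.support, ‖c i • T (u i).1‖ := norm_sum_le _ _
      _ ≤ ∑ i ∈ c.support, ((1:ℝ) / 2) ^ i * (η * ‖z‖ / 2) := by
          refine Finset.sum_le_sum fun i _ => ?_
          rw [norm_smul, Real.norm_eq_abs]
          calc |c i| * ‖T (u i).1‖ ≤ (2 ^ i * ‖z‖) * (η * ((1 / 4) ^ i / 2)) := by
                refine mul_le_mul (hco i) ((hu i).2.2.2.2.trans ?_) (norm_nonneg _) (by positivity)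
                exact mul_le_mul_of_nonneg_left (hδ i) hη.le
            _ = (2 ^ i * (1 / 4) ^ i) * (η * ‖z‖ / 2) := by ring
            _ = _ := by rw [← mul_pow]; norm_num
      _ = (∑ i ∈ c.support, ((1:ℝ) / 2) ^ i) * (η * ‖z‖ / 2) := by rw [Finset.sum_mul]
      _ ≤ 2 * (η * ‖z‖ / 2) := by gcongr
      _ = η * ‖z‖ := by ring

theorem aux_iter {X : Type*} [NormedAddCommGroup X] [NormedSpace ℝ X]
    (T : X →L[ℝ] X) (hT : StrictlySingular T) (hinj : Function.Injective T)
    (η : ℝ) (hη : 0 < η) (V : Submodule ℝ X) (hV : ¬ FiniteDimensional ℝ V) (k : ℕ) :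
    ∃ W : Submodule ℝ X, W ≤ V ∧ ¬ FiniteDimensional ℝ W ∧
      ∀ w ∈ W, ∀ i < k, ‖(T ^ (i + 1)) w‖ ≤ η * ‖(T ^ i) w‖ := by
  induction k with
  | zero => exact ⟨V, le_rfl, hV, by simp⟩
  | succ k ih =>
    obtain ⟨W, hWV, hW, hb⟩ := ih
    have hik : Function.Injective (T ^ k : X →L[ℝ] X) := by
      rw [FunLike.coe_pow_eq_iterate]
      exact hinj.iterate k
    set S : X →ₗ[ℝ] X := (T ^ k : X →L[ℝ] X).toLinearMap with hS
    have hSi : Function.Injective S := hik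
    obtain ⟨U, hU, hUf, hUb⟩ := aux_core T hT (W.map S) (by
      intro h
      exact hW (LinearEquiv.finiteDimensional (Submodule.equivMapOfInjective S hSi W).symm)) η hη
    refine ⟨W ⊓ U.comap S, inf_le_left.trans hWV, ?_, ?_⟩
    · intro h
      apply hUf
      have h2 : FiniteDimensional ℝ ((W ⊓ U.comap S).map S) := inferInstance
      refine Submodule.finiteDimensional_of_le (S₂ := (W ⊓ U.comap S).map S) ?_
      intro y hy
      obtain ⟨w, hw, rfl⟩ := hU hy
      exact ⟨w, ⟨hw, hy⟩, rfl⟩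
    · intro w hw i hi
      rcases Nat.lt_succ_iff_lt_or_eq.mp hi with hi | rfl
      · exact hb w hw.1 i hi
      · rw [pow_succ']
        exact hUb _ hw.2

theorem stmt_2 {X : Type*} [NormedAddCommGroup X] [NormedSpace ℝ X] [CompleteSpace X]
    (hX : ¬ FiniteDimensional ℝ X) (T : X →L[ℝ] X)
    (hT : StrictlySingular T) (hinj : Function.Injective T)
    (k : ℕ) (hk : 0 < k) (η : ℝ) (hη : 0 < η)
    (Y : Submodule ℝ X) (hYc : IsClosed (Y : Set X)) (hY : ¬ FiniteDimensional ℝ Y) :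
    ∃ Z : Submodule ℝ X, Z ≤ Y ∧ IsClosed (Z : Set X) ∧ ¬ FiniteDimensional ℝ Z ∧
      ∀ z ∈ Z, ∀ i, 1 ≤ i → i ≤ k → ‖(T ^ i) z‖ ≤ η * ‖(T ^ (i - 1)) z‖ := by
  obtain ⟨W, hWY, hW, hb⟩ := aux_iter T hT hinj η hη Y hY k
  refine ⟨W.topologicalClosure, W.topologicalClosure_minimal hWY hYc,
    W.isClosed_topologicalClosure, ?_, ?_⟩
  · intro hfin
    exact hW (Submodule.finiteDimensional_of_le W.le_topologicalClosure)
  · intro z hz i h1 hik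
    obtain ⟨j, rfl⟩ : ∃ j, i = j + 1 := ⟨i - 1, by omega⟩
    rw [Nat.add_sub_cancel]
    have hcl : IsClosed {y : X | ‖(T ^ (j + 1)) y‖ ≤ η * ‖(T ^ j) y‖} :=
      isClosed_le (by fun_prop) (by fun_prop)
    exact closure_minimal (s := (W : Set X)) (fun w hw => hb w hw j (by omega)) hcl hz
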